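/- There is an absolute constant c > 0 such that for every real ε with 0 < ε < 1 there exists K such that for every integer k ≥ K there is a set U of k-permutations with |U| ≥ (1−ε)·k! and liminf_{n→∞} ex(n,U)/n ≥ 2^{c·(k/log₂ k)^{1/4}}. -/

import Mathlib

open Filter

/-- A binary matrix `A` contains a binary matrix `P` (as a submatrix pattern):
there are strictly increasing choices of rows and columns such that `A` has a
one wherever `P` does. -/
def ContainsMat {k l m n : ℕ} (P : Fin k → Fin l → Bool) (A : Fin m → Fin n → Bool) : Prop :=
  ∃ (r : Fin k → Fin m) (c : Fin l → Fin n), StrictMono r ∧ StrictMono c ∧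
    ∀ i j, P i j = true → A (r i) (c j) = true

/-- The permutation matrix of a permutation of `{1,…,k}`. -/
def permMatrix {k : ℕ} (π : Equiv.Perm (Fin k)) : Fin k → Fin k → Bool :=
  fun i j => decide (π i = j)

/-- The mass of a binary matrix: the number of its one-entries. -/
def mass {m n : ℕ} (A : Fin m → Fin n → Bool) : ℕ :=
  (Finset.univ.filter fun p : Fin m × Fin n => A p.1 p.2 = true).card

/-- A binary matrix avoids a permutation if it avoids its permutation matrix. -/
def AvoidsPerm {k m n : ℕ} (A : Fin m → Fin n → Bool) (π : Equiv.Perm (Fin k)) : Prop :=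
  ¬ ContainsMat (permMatrix π) A

/-- `ex n π`: the maximum mass of an `n × n` binary matrix avoiding `π`. -/
noncomputable def exP {k : ℕ} (n : ℕ) (π : Equiv.Perm (Fin k)) : ℕ :=
  sSup {m | ∃ A : Fin n → Fin n → Bool, AvoidsPerm A π ∧ mass A = m}

/-- `ex n U` for a set `U` of permutations: the maximum mass of an `n × n`
binary matrix avoiding every permutation in `U`. -/
noncomputable def exU {k : ℕ} (n : ℕ) (U : Finset (Equiv.Perm (Fin k))) : ℕ :=
  sSup {m | ∃ A : Fin n → Fin n → Bool, (∀ π ∈ U, AvoidsPerm A π) ∧ mass A = m}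

/-- An `n`-permutation `σ` contains a `k`-permutation `π`. -/
def PermContains {n k : ℕ} (σ : Equiv.Perm (Fin n)) (π : Equiv.Perm (Fin k)) : Prop :=
  ∃ x : Fin k → Fin n, StrictMono x ∧ ∀ i j, σ (x i) < σ (x j) ↔ π i < π j

/-- `S n π`: the number of `n`-permutations avoiding `π`. -/
noncomputable def SP {k : ℕ} (n : ℕ) (π : Equiv.Perm (Fin k)) : ℕ :=
  Nat.card {σ : Equiv.Perm (Fin n) // ¬ PermContains σ π}

/-- `S n U`: the number of `n`-permutations avoiding every permutation in `U`. -/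
noncomputable def SU {k : ℕ} (n : ℕ) (U : Finset (Equiv.Perm (Fin k))) : ℕ :=
  Nat.card {σ : Equiv.Perm (Fin n) // ∀ π ∈ U, ¬ PermContains σ π}

/-- `T n π`: the number of `n × n` binary matrices avoiding `π`. -/
noncomputable def TP {k : ℕ} (n : ℕ) (π : Equiv.Perm (Fin k)) : ℕ :=
  Nat.card {A : Fin n → Fin n → Bool // AvoidsPerm A π}

/-- `P` is an interval minor of `A`: there are ordered disjoint row intervals
`[rlo a, rhi a]` and column intervals `[clo b, chi b]` such that wherever `P`
has a one, the corresponding block of `A` contains a one. -/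
def IntervalMinor {k l m n : ℕ} (P : Fin k → Fin l → Bool) (A : Fin m → Fin n → Bool) : Prop :=
  ∃ (rlo rhi : Fin k → Fin m) (clo chi : Fin l → Fin n),
    (∀ a, rlo a ≤ rhi a) ∧ (∀ a b, a < b → rhi a < rlo b) ∧
    (∀ a, clo a ≤ chi a) ∧ (∀ a b, a < b → chi a < clo b) ∧
    ∀ a b, P a b = true → ∃ i j, rlo a ≤ i ∧ i ≤ rhi a ∧ clo b ≤ j ∧ j ≤ chi b ∧ A i j = true

/-- The all-ones `k × l` binary matrix. -/
def J (k l : ℕ) : Fin k → Fin l → Bool := fun _ _ => true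

/-- `m n P`: the maximum mass of an `n × n` binary matrix avoiding `P` as an
interval minor. -/
noncomputable def mP {k l : ℕ} (n : ℕ) (P : Fin k → Fin l → Bool) : ℕ :=
  sSup {m | ∃ A : Fin n → Fin n → Bool, ¬ IntervalMinor P A ∧ mass A = m}

/-- `f_P(t,s)`: the supremum (in `ℕ∞`) of those `N` for which there is an
`N × t` binary matrix with at least `s` ones in each row avoiding `P` as an
interval minor. -/
noncomputable def fP {k l : ℕ} (P : Fin k → Fin l → Bool) (t s : ℕ) : ℕ∞ :=
  sSup {x : ℕ∞ | ∃ N : ℕ, x = (N : ℕ∞) ∧ ∃ A : Fin N → Fin t → Bool,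
    (∀ i, s ≤ (Finset.univ.filter fun j => A i j = true).card) ∧ ¬ IntervalMinor P A}

/-- `g_P(t,s)`: the supremum (in `ℕ∞`) of those `N` for which there is a
`t × N` binary matrix with at least `s` ones in each column avoiding `P` as an
interval minor. -/
noncomputable def gP {k l : ℕ} (P : Fin k → Fin l → Bool) (t s : ℕ) : ℕ∞ :=
  sSup {x : ℕ∞ | ∃ N : ℕ, x = (N : ℕ∞) ∧ ∃ A : Fin t → Fin N → Bool,
    (∀ j, s ≤ (Finset.univ.filter fun i => A i j = true).card) ∧ ¬ IntervalMinor P A}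

def HasJ (l : ℕ) (S : Set (ℕ × ℕ)) : Prop :=
  ∃ e : ℕ → ℕ → ℕ × ℕ, (∀ i j, i < l → j < l → e i j ∈ S) ∧
    (∀ i i' j j', i < i' → i' < l → j < l → j' < l → (e i j).1 < (e i' j').1) ∧
    (∀ i i' j j', j < j' → j' < l → i < l → i' < l → (e i j).2 < (e i' j').2)

theorem HasJ.mono {l : ℕ} {S S' : Set (ℕ × ℕ)} (h : HasJ l S) (hS : S ⊆ S') : HasJ l S' := by
  obtain ⟨e, h1, h2, h3⟩ := h
  exact ⟨e, fun i j hi hj => hS (h1 i j hi hj), h2, h3⟩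

theorem HasJ.swap {l : ℕ} {S : Set (ℕ × ℕ)} (h : HasJ l S) : HasJ l (Prod.swap '' S) := by
  obtain ⟨e, h1, h2, h3⟩ := h
  refine ⟨fun i j => (e j i).swap, fun i j hi hj => ⟨_, h1 j i hj hi, rfl⟩, ?_, ?_⟩
  · intro i i' j j' a b c d
    exact h3 j j' i i' a b c d
  · intro i i' j j' a b c d
    exact h2 j j' i i' a b c d
theorem mt_wide (k s n : ℕ) (hs : 0 < s) (S : Finset (ℕ × ℕ))
    (hS : S ⊆ Finset.range (n * s) ×ˢ Finset.range (n * s)) (h : ¬ HasJ k (S : Set (ℕ × ℕ))) :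
    (((S.image fun p => (p.1 / s, p.2 / s))).filter fun b =>
      k ≤ ((S.filter fun p => (p.1 / s, p.2 / s) = b).image fun p => p.2 % s).card).card
      ≤ k * (n * 2 ^ s) := by
  classical
  set cols : ℕ × ℕ → Finset ℕ := fun b =>
    (S.filter fun p => (p.1 / s, p.2 / s) = b).image fun p => p.2 % s with hcols
  have key := Finset.card_le_mul_card_image_of_maps_to
    (s := (((S.image fun p => (p.1 / s, p.2 / s))).filter fun b => k ≤ (cols b).card))
    (t := Finset.range n ×ˢ (Finset.range s).powerset) (f := fun b => (b.2, cols b)) ?_ k ?_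
  · simpa using key
  · intro b hb
    simp only [Finset.mem_filter, Finset.mem_image] at hb
    obtain ⟨⟨p, hp, rfl⟩, -⟩ := hb
    have := hS hp
    simp only [Finset.mem_product, Finset.mem_range] at this
    simp only [Finset.mem_product, Finset.mem_range, Finset.mem_powerset]
    refine ⟨(Nat.div_lt_iff_lt_mul hs).2 this.2, ?_⟩
    intro x hx
    simp only [hcols, Finset.mem_image] at hx
    obtain ⟨q, -, rfl⟩ := hx
    exact Finset.mem_range.2 (Nat.mod_lt _ hs)
  · rintro ⟨c, T⟩ -
    by_contra hlt
    push Not at hlt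
    apply h
    set W := (((S.image fun p => (p.1 / s, p.2 / s))).filter fun b => k ≤ (cols b).card).filter
      (fun b => (b.2, cols b) = (c, T)) with hW
    have hW' : ∀ b ∈ W, b.2 = c ∧ cols b = T ∧ k ≤ T.card := by
      intro b hb
      simp only [hW, Finset.mem_filter, Prod.mk.injEq] at hb
      obtain ⟨⟨_, h1⟩, h2, h3⟩ := hb
      exact ⟨h2, h3, h3 ▸ h1⟩
    have hT : k ≤ T.card := by
      obtain ⟨b, hb⟩ : W.Nonempty := Finset.card_pos.1 (by omega)
      exact (hW' b hb).2.2
    set Rw := W.image Prod.fst with hRw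
    have hRc : Rw.card = W.card := by
      apply Finset.card_image_of_injOn
      intro a ha b hb hab
      exact Prod.ext hab ((hW' a ha).1.trans (hW' b hb).1.symm)
    let f := Rw.orderEmbOfFin rfl
    let g := T.orderEmbOfFin rfl
    have hf : ∀ i, (f i, c) ∈ W := by
      intro i
      have : f i ∈ Rw := Finset.orderEmbOfFin_mem _ _ _
      obtain ⟨b, hb, hb'⟩ := Finset.mem_image.1 this
      have : b = (f i, c) := Prod.ext hb' (hW' b hb).1
      exact this ▸ hb
    have hex : ∀ i j, ∃ p ∈ S, p.1 / s = f i ∧ p.2 / s = c ∧ p.2 % s = g j := by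
      intro i j
      have h1 : g j ∈ T := Finset.orderEmbOfFin_mem _ _ _
      replace h1 : g j ∈ cols (f i, c) := by
        rw [(hW' _ (hf i)).2.1]; exact h1
      simp only [hcols, Finset.mem_image, Finset.mem_filter, Prod.mk.injEq] at h1
      obtain ⟨p, ⟨hp, h2, h3⟩, h4⟩ := h1
      exact ⟨p, hp, h2, h3, h4⟩
    choose e he1 he2 he3 he4 using hex
    refine ⟨fun i j => if hi : i < Rw.card then if hj : j < T.card then e ⟨i, hi⟩ ⟨j, hj⟩ else (0,0)
      else (0,0), ?_, ?_, ?_⟩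
    · intro i j hi hj
      have hi' : i < Rw.card := by omega
      have hj' : j < T.card := by omega
      simp only [hi', hj', dif_pos]
      exact he1 _ _
    · intro i i' j j' hii hi hj hj'
      have a1 : i < Rw.card := by omega
      have a2 : i' < Rw.card := by omega
      have a3 : j < T.card := by omega
      have a4 : j' < T.card := by omega
      simp only [a1, a2, a3, a4, dif_pos]
      by_contra hle
      push Not at hle
      have := Nat.div_le_div_right (c := s) hle
      rw [he2, he2] at this
      have h5 : f ⟨i, a1⟩ < f ⟨i', a2⟩ := f.strictMono hii
      omega
    · intro i i' j j' hii hi hj hj'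
      have a1 : i < Rw.card := by omega
      have a2 : i' < Rw.card := by omega
      have a3 : j < T.card := by omega
      have a4 : j' < T.card := by omega
      simp only [a1, a2, a3, a4, dif_pos]
      rw [← Nat.div_add_mod (e ⟨i, a1⟩ ⟨j, a3⟩).2 s, ← Nat.div_add_mod (e ⟨i', a2⟩ ⟨j', a4⟩).2 s,
        he3, he3, he4, he4]
      have h5 : g ⟨j, a3⟩ < g ⟨j', a4⟩ := g.strictMono hii
      omega

theorem mt_step (k s n C : ℕ) (hs : 0 < s)
    (IH : ∀ S : Finset (ℕ × ℕ), S ⊆ Finset.range n ×ˢ Finset.range n →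
      ¬ HasJ k (S : Set (ℕ × ℕ)) → S.card ≤ C)
    (S : Finset (ℕ × ℕ))
    (hS : S ⊆ Finset.range (n * s) ×ˢ Finset.range (n * s)) (h : ¬ HasJ k (S : Set (ℕ × ℕ))) :
    S.card ≤ k * k * C + 2 * (s * s * (k * (n * 2 ^ s))) := by
  classical
  set φ : ℕ × ℕ → ℕ × ℕ := fun p => (p.1 / s, p.2 / s) with hφ
  set B := S.image φ with hB
  set cols : ℕ × ℕ → Finset ℕ := fun b => (S.filter fun p => φ p = b).image fun p => p.2 % s
    with hcols
  set rows : ℕ × ℕ → Finset ℕ := fun b => (S.filter fun p => φ p = b).image fun p => p.1 % s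
    with hrows
  have hBc : B.card ≤ C := by
    apply IH
    · intro b hb
      obtain ⟨p, hp, rfl⟩ := Finset.mem_image.1 hb
      have := hS hp
      simp only [Finset.mem_product, Finset.mem_range] at this
      simp only [Finset.mem_product, Finset.mem_range, hφ]
      exact ⟨(Nat.div_lt_iff_lt_mul hs).2 this.1, (Nat.div_lt_iff_lt_mul hs).2 this.2⟩
    · rintro ⟨e, h1, h2, h3⟩
      apply h
      have : ∀ i j, ∃ p : ℕ × ℕ, i < k → j < k → p ∈ S ∧ φ p = e i j := by
        intro i j
        by_cases hi : i < k
        · by_cases hj : j < k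
          · obtain ⟨p, hp, hp'⟩ := Finset.mem_image.1 (h1 i j hi hj)
            exact ⟨p, fun _ _ => ⟨hp, hp'⟩⟩
          · exact ⟨(0,0), fun _ h => absurd h hj⟩
        · exact ⟨(0,0), fun h => absurd h hi⟩
      choose e' he' using this
      refine ⟨e', fun i j hi hj => (he' i j hi hj).1, ?_, ?_⟩
      · intro i i' j j' a b c d
        have h4 := h2 i i' j j' a b c d
        rw [← (he' i j (by omega) c).2, ← (he' i' j' b d).2] at h4
        by_contra hle
        push Not at hle
        have := Nat.div_le_div_right (c := s) hle
        simp only [hφ] at h4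
        omega
      · intro i i' j j' a b c d
        have h4 := h3 i i' j j' a b c d
        rw [← (he' i j c (by omega)).2, ← (he' i' j' d b).2] at h4
        by_contra hle
        push Not at hle
        have := Nat.div_le_div_right (c := s) hle
        simp only [hφ] at h4
        omega
  have hwide : (B.filter fun b => k ≤ (cols b).card).card ≤ k * (n * 2 ^ s) :=
    mt_wide k s n hs S hS h
  have htall : (B.filter fun b => k ≤ (rows b).card).card ≤ k * (n * 2 ^ s) := by
    have := mt_wide k s n hs (S.image Prod.swap) ?_ ?_
    · refine le_trans ?_ this
      apply Finset.card_le_card_of_injOn Prod.swap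
      · intro b hb
        simp only [Finset.coe_filter, Set.mem_ofPred_eq, hB, Finset.mem_image] at hb ⊢
        obtain ⟨⟨p, hp, rfl⟩, h2⟩ := hb
        refine ⟨⟨p.swap, ⟨p, hp, rfl⟩, rfl⟩, ?_⟩
        refine le_trans h2 (Finset.card_le_card ?_)
        intro x hx
        simp only [hrows, Finset.mem_image, Finset.mem_filter] at hx ⊢
        obtain ⟨q, ⟨hq, hq2⟩, rfl⟩ := hx
        refine ⟨q.swap, ⟨⟨q, hq, rfl⟩, ?_⟩, rfl⟩
        rw [← hq2]; rfl
      · exact Prod.swap_injective.injOn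
    · intro p hp
      obtain ⟨q, hq, rfl⟩ := Finset.mem_image.1 hp
      have := hS hq
      simp only [Finset.mem_product, Finset.mem_range, Prod.fst_swap, Prod.snd_swap] at this ⊢
      exact this.symm
    · intro hJ
      apply h
      have := hJ.swap
      rw [Finset.coe_image, ← Set.image_comp] at this
      simpa using this
  have hfib : ∀ b ∈ B, (S.filter fun p => φ p = b).card ≤
      k * k + (if k ≤ (cols b).card then s * s else 0) + (if k ≤ (rows b).card then s * s else 0) := by
    intro b hb
    have h1 : (S.filter fun p => φ p = b).card ≤ (rows b).card * (cols b).card := by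
      rw [← Finset.card_product]
      apply Finset.card_le_card_of_injOn (fun p => (p.1 % s, p.2 % s))
      · intro p hp
        simp only [Finset.coe_product, Set.mem_prod, Finset.mem_coe]
        exact ⟨Finset.mem_image_of_mem (fun p : ℕ × ℕ => p.1 % s) hp,
          Finset.mem_image_of_mem (fun p : ℕ × ℕ => p.2 % s) hp⟩
      · intro p hp q hq hpq
        simp only [Finset.coe_filter, Set.mem_ofPred_eq, hφ] at hp hq
        have e1 := hp.2.trans hq.2.symm
        simp only [Prod.mk.injEq] at e1 hpq
        refine Prod.ext ?_ ?_
        · rw [← Nat.div_add_mod p.1 s, ← Nat.div_add_mod q.1 s, e1.1, hpq.1]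
        · rw [← Nat.div_add_mod p.2 s, ← Nat.div_add_mod q.2 s, e1.2, hpq.2]
    have h2 : (rows b).card ≤ s := by
      calc _ ≤ (Finset.range s).card := Finset.card_le_card (by
            intro x hx
            obtain ⟨q, -, rfl⟩ := Finset.mem_image.1 hx
            exact Finset.mem_range.2 (Nat.mod_lt _ hs))
        _ = s := by simp
    have h3 : (cols b).card ≤ s := by
      calc _ ≤ (Finset.range s).card := Finset.card_le_card (by
            intro x hx
            obtain ⟨q, -, rfl⟩ := Finset.mem_image.1 hx
            exact Finset.mem_range.2 (Nat.mod_lt _ hs))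
        _ = s := by simp
    refine h1.trans ?_
    have h4 : (rows b).card * (cols b).card ≤ s * s := Nat.mul_le_mul h2 h3
    by_cases c1 : k ≤ (cols b).card
    · rw [if_pos c1]; omega
    · by_cases c2 : k ≤ (rows b).card
      · rw [if_pos c2]; omega
      · have : (rows b).card * (cols b).card ≤ k * k := Nat.mul_le_mul (by omega) (by omega)
        omega
  calc S.card = ∑ b ∈ B, (S.filter fun p => φ p = b).card :=
        Finset.card_eq_sum_card_image φ S
    _ ≤ ∑ b ∈ B, (k * k + (if k ≤ (cols b).card then s * s else 0) +
          (if k ≤ (rows b).card then s * s else 0)) := Finset.sum_le_sum hfib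
    _ = k * k * B.card + s * s * (B.filter fun b => k ≤ (cols b).card).card +
          s * s * (B.filter fun b => k ≤ (rows b).card).card := by
        rw [Finset.sum_add_distrib, Finset.sum_add_distrib, ← Finset.sum_filter,
          ← Finset.sum_filter]
        simp [mul_comm]
    _ ≤ _ := by
        have a1 := Nat.mul_le_mul_left (k * k) hBc
        have a2 := Nat.mul_le_mul_left (s * s) hwide
        have a3 := Nat.mul_le_mul_left (s * s) htall
        omega

theorem mt_main (k : ℕ) : ∃ C : ℕ, ∀ t : ℕ, ∀ S : Finset (ℕ × ℕ),
    S ⊆ Finset.range ((k * k + 2) ^ t) ×ˢ Finset.range ((k * k + 2) ^ t) →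
    ¬ HasJ k (S : Set (ℕ × ℕ)) → S.card ≤ C * (k * k + 2) ^ t := by
  set s := k * k + 2 with hs
  refine ⟨1 + 2 * (s * s * (k * 2 ^ s)), ?_⟩
  set D := 2 * (s * s * (k * 2 ^ s)) with hD
  intro t
  induction t with
  | zero =>
    intro S hS _
    have := Finset.card_le_card hS
    simp at this
    simp; omega
  | succ t ih =>
    intro S hS h
    rw [pow_succ] at hS
    have := mt_step k s (s ^ t) _ (by omega) ih S hS h
    refine this.trans ?_
    have e1 : 2 * (s * s * (k * (s ^ t * 2 ^ s))) = D * s ^ t := by rw [hD]; ring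
    rw [e1, pow_succ]
    have e2 : (1 + D) * (s ^ t * s) = k * k * ((1 + D) * s ^ t) + 2 * (1 + D) * s ^ t := by
      conv_lhs => rw [hs]
      ring
    rw [e2]
    nlinarith [Nat.zero_le (s ^ t), Nat.zero_le (D * s ^ t)]
theorem perm_step {k : ℕ} (A B : Finset (Fin k)) (x : Fin k) (hx : x ∉ A) :
    k * (Finset.univ.filter fun π : Equiv.Perm (Fin k) => ∀ a ∈ insert x A, π a ∉ B).card ≤
    (k - B.card) * (Finset.univ.filter fun π : Equiv.Perm (Fin k) => ∀ a ∈ A, π a ∉ B).card := by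
  classical
  set G := Finset.univ.filter fun π : Equiv.Perm (Fin k) => ∀ a ∈ A, π a ∉ B with hG
  let c : Fin k → ℕ := fun y => (G.filter fun π => π x = y).card
  have hc : ∀ y ∈ B, ∀ y' ∈ Bᶜ, c y' ≤ c y := by
    intro y hy y' hy'
    rw [Finset.mem_compl] at hy'
    apply Finset.card_le_card_of_injOn (fun π => Equiv.swap y y' * π)
    · intro π hπ
      simp only [Finset.coe_filter, Set.mem_ofPred_eq, hG, Finset.mem_filter, Finset.mem_univ,
        true_and] at hπ ⊢
      refine ⟨?_, by simp [hπ.2]⟩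
      intro a ha
      have h1 := hπ.1 a ha
      simp only [Equiv.Perm.mul_apply]
      by_cases e1 : π a = y
      · rw [e1, Equiv.swap_apply_left]; exact hy'
      · have e2 : π a ≠ y' := by
          intro e2
          have : a = x := π.injective (e2.trans hπ.2.symm)
          exact hx (this ▸ ha)
        rw [Equiv.swap_apply_of_ne_of_ne e1 e2]; exact h1
    · intro π _ σ _ h
      exact mul_left_cancel h
  have h1 : (Finset.univ.filter fun π : Equiv.Perm (Fin k) => ∀ a ∈ insert x A, π a ∉ B).card
      = ∑ y' ∈ Bᶜ, c y' := by
    rw [Finset.card_eq_sum_card_fiberwise (f := fun π => π x) (t := Bᶜ)]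
    · apply Finset.sum_congr rfl
      intro y hy
      rw [Finset.mem_compl] at hy
      congr 1
      ext π
      simp only [hG, Finset.mem_filter, Finset.mem_univ, true_and, Finset.mem_insert,
        forall_eq_or_imp]
      constructor
      · rintro ⟨⟨_, h⟩, h'⟩; exact ⟨h, h'⟩
      · rintro ⟨h, h'⟩; exact ⟨⟨h' ▸ hy, h⟩, h'⟩
    · intro π hπ
      simp at hπ
      simp [hπ.1]
  have h2 : G.card = ∑ y ∈ B, c y + ∑ y' ∈ Bᶜ, c y' := by
    rw [Finset.sum_add_sum_compl]
    exact Finset.card_eq_sum_card_fiberwise (fun _ _ => Finset.mem_univ _)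
  have h3 : B.card * ∑ y' ∈ Bᶜ, c y' ≤ (k - B.card) * ∑ y ∈ B, c y := by
    have : ∑ y ∈ B, ∑ y' ∈ Bᶜ, c y' ≤ ∑ y ∈ B, ∑ y' ∈ Bᶜ, c y :=
      Finset.sum_le_sum fun y hy => Finset.sum_le_sum fun y' hy' => hc y hy y' hy'
    simp only [Finset.sum_const, smul_eq_mul, Finset.card_compl, Fintype.card_fin] at this
    rwa [← Finset.mul_sum] at this
  have hBk : B.card ≤ k := by simpa using Finset.card_le_univ B
  rw [h1, h2]
  set X := ∑ y' ∈ Bᶜ, c y'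
  set Y := ∑ y ∈ B, c y
  obtain ⟨d, hd⟩ := Nat.exists_eq_add_of_le hBk
  have : k - B.card = d := by omega
  rw [this] at h3 ⊢
  conv_lhs => rw [hd]
  nlinarith

theorem perm_count {k : ℕ} (A B : Finset (Fin k)) :
    k ^ A.card * (Finset.univ.filter fun π : Equiv.Perm (Fin k) => ∀ a ∈ A, π a ∉ B).card ≤
    (k - B.card) ^ A.card * k.factorial := by
  classical
  induction A using Finset.induction_on with
  | empty => simp [Fintype.card_perm]
  | insert x A hx ih =>
    rw [Finset.card_insert_of_notMem hx]
    have := perm_step A B x hx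
    calc _ = k ^ A.card * (k * (Finset.univ.filter fun π : Equiv.Perm (Fin k) =>
              ∀ a ∈ insert x A, π a ∉ B).card) := by ring
      _ ≤ k ^ A.card * ((k - B.card) * (Finset.univ.filter fun π : Equiv.Perm (Fin k) =>
              ∀ a ∈ A, π a ∉ B).card) := Nat.mul_le_mul_left _ this
      _ = (k - B.card) * (k ^ A.card * (Finset.univ.filter fun π : Equiv.Perm (Fin k) =>
              ∀ a ∈ A, π a ∉ B).card) := by ring
      _ ≤ (k - B.card) * ((k - B.card) ^ A.card * k.factorial) := Nat.mul_le_mul_left _ ih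
      _ = _ := by ring

def pset {k : ℕ} (π : Equiv.Perm (Fin k)) : Set (ℕ × ℕ) :=
  {p | ∃ i : Fin k, p = ((i : ℕ), (π i : ℕ))}

def blk (k w a : ℕ) : Finset (Fin k) := Finset.univ.filter fun i => (i : ℕ) / w = a

theorem blk_card (k w a l : ℕ) (hw : 0 < w) (h : l * w ≤ k) (ha : a < l) : (blk k w a).card = w := by
  have hle : (a + 1) * w ≤ k := le_trans (Nat.mul_le_mul_right w ha) h
  have hle' : a * w + w ≤ k := by rw [add_mul, one_mul] at hle; exact hle
  have : (blk k w a).map Fin.valEmbedding = Finset.Ico (a * w) (a * w + w) := by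
    ext x
    simp only [blk, Finset.mem_map, Finset.mem_filter, Finset.mem_univ, true_and,
      Fin.valEmbedding_apply, Finset.mem_Ico]
    constructor
    · rintro ⟨i, h1, rfl⟩
      rw [Nat.div_eq_iff hw] at h1
      omega
    · rintro ⟨h1, h2⟩
      refine ⟨⟨x, by omega⟩, ?_, rfl⟩
      rw [Nat.div_eq_iff hw]
      simp only
      omega
  rw [← Finset.card_map, this]; simp

theorem pset_hasJ {k l w : ℕ} (π : Equiv.Perm (Fin k))
    (h : ∀ a < l, ∀ b < l, ¬ ∀ i ∈ blk k w a, π i ∉ blk k w b) : HasJ l (pset π) := by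
  have : ∀ a b, ∃ p : ℕ × ℕ, a < l → b < l → p ∈ pset π ∧ p.1 / w = a ∧ p.2 / w = b := by
    intro a b
    by_cases ha : a < l
    · by_cases hb : b < l
      · have := h a ha b hb
        push Not at this
        obtain ⟨i, h1, h2⟩ := this
        simp only [blk, Finset.mem_filter, Finset.mem_univ, true_and] at h1 h2
        exact ⟨(i, π i), fun _ _ => ⟨⟨i, rfl⟩, h1, h2⟩⟩
      · exact ⟨(0,0), fun _ h => absurd h hb⟩
    · exact ⟨(0,0), fun h => absurd h ha⟩
  choose e he using this
  refine ⟨e, fun i j hi hj => (he i j hi hj).1, ?_, ?_⟩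
  · intro i i' j j' a b c d
    by_contra hle
    push Not at hle
    have h1 := Nat.div_le_div_right (c := w) hle
    have h2 := (he i j (by omega) c).2.1
    have h3 := (he i' j' b d).2.1
    omega
  · intro i i' j j' a b c d
    by_contra hle
    push Not at hle
    have h1 := Nat.div_le_div_right (c := w) hle
    have h2 := (he i j c (by omega)).2.2
    have h3 := (he i' j' d b).2.2
    omega

open Classical in
theorem perm_good (k l w : ℕ) (hw : 0 < w) (h : l * w ≤ k) (hk : 0 < k) :
    (1 - (l : ℝ) ^ 2 * (1 - (w : ℝ) / k) ^ w) * (k.factorial : ℝ) ≤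
    ((Finset.univ.filter fun π : Equiv.Perm (Fin k) => HasJ l (pset π)).card : ℝ) := by
  set U := Finset.univ.filter fun π : Equiv.Perm (Fin k) => HasJ l (pset π) with hU
  have hsub : Uᶜ ⊆ (Finset.range l ×ˢ Finset.range l).biUnion fun q =>
      Finset.univ.filter fun π : Equiv.Perm (Fin k) => ∀ a ∈ blk k w q.1, π a ∉ blk k w q.2 := by
    intro π hπ
    simp only [hU, Finset.mem_compl, Finset.mem_filter, Finset.mem_univ, true_and] at hπ
    by_contra hcon
    apply hπ
    apply pset_hasJ (w := w)
    intro a ha b hb hh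
    apply hcon
    simp only [Finset.mem_biUnion, Finset.mem_product, Finset.mem_range, Finset.mem_filter,
      Finset.mem_univ, true_and]
    exact ⟨(a, b), ⟨ha, hb⟩, hh⟩
  have hb : ∀ q ∈ Finset.range l ×ˢ Finset.range l,
      (((Finset.univ.filter fun π : Equiv.Perm (Fin k) =>
        ∀ a ∈ blk k w q.1, π a ∉ blk k w q.2).card : ℕ) : ℝ) ≤
        (1 - (w : ℝ) / k) ^ w * (k.factorial : ℝ) := by
    intro q hq
    simp only [Finset.mem_product, Finset.mem_range] at hq
    have h1 := perm_count (blk k w q.1) (blk k w q.2)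
    rw [blk_card k w q.1 l hw h hq.1, blk_card k w q.2 l hw h hq.2] at h1
    have hwk : w ≤ k := by nlinarith
    have h2 : (k : ℝ) ^ w * ((Finset.univ.filter fun π : Equiv.Perm (Fin k) =>
        ∀ a ∈ blk k w q.1, π a ∉ blk k w q.2).card : ℝ) ≤
        ((k : ℝ) - w) ^ w * (k.factorial : ℝ) := by
      rw [← Nat.cast_sub hwk]; exact_mod_cast h1
    have hk' : (0 : ℝ) < k := by exact_mod_cast hk
    have h3 : (1 - (w : ℝ) / k) ^ w = ((k : ℝ) - w) ^ w / (k : ℝ) ^ w := by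
      rw [← div_pow]; congr 1; field_simp
    rw [h3, div_mul_eq_mul_div, le_div_iff₀ (by positivity)]
    linarith
  have hcard : ((Uᶜ.card : ℕ) : ℝ) ≤ (l : ℝ) ^ 2 * ((1 - (w : ℝ) / k) ^ w * (k.factorial : ℝ)) := by
    calc ((Uᶜ.card : ℕ) : ℝ) ≤ _ := Nat.cast_le.2 (Finset.card_le_card hsub)
      _ ≤ _ := Nat.cast_le.2 Finset.card_biUnion_le
      _ = _ := by rw [Nat.cast_sum]
      _ ≤ _ := Finset.sum_le_sum hb
      _ = _ := by
        rw [Finset.sum_const, Finset.card_product, Finset.card_range, nsmul_eq_mul]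
        push_cast; ring
  have htot : (U.card : ℝ) + (Uᶜ.card : ℝ) = k.factorial := by
    rw [← Nat.cast_add, Finset.card_add_card_compl, Fintype.card_perm, Fintype.card_fin]
  linarith
theorem dy_lt {R x : ℕ} (s : ℕ) (h : x < 2 ^ R) : x / 2 ^ s < 2 ^ R :=
  lt_of_le_of_lt (Nat.div_le_self _ _) h

abbrev Nd (R : ℕ) := Fin (R + 1) × Fin (2 ^ R)

def nd {R : ℕ} (s : Fin (R + 1)) (x : Fin (2 ^ R)) : Nd R := (s, ⟨x / 2 ^ (s : ℕ), dy_lt s x.2⟩)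

theorem exists_nodes (R l : ℕ) (hl : 0 < l) (X : Fin l → Fin l → Fin (2 ^ R))
    (hX : ∀ i i' j j', i < i' → X i j < X i' j') :
    ∃ a : Fin l → Nd R, Function.Injective a ∧ ∀ i j, ∃ s, a i = nd s (X i j) := by
  classical
  have hex : ∀ i, ∃ s, ∀ j j', (X i j : ℕ) / 2 ^ s = (X i j' : ℕ) / 2 ^ s := by
    intro i
    refine ⟨R, fun j j' => ?_⟩
    rw [Nat.div_eq_of_lt (X i j).2, Nat.div_eq_of_lt (X i j').2]
  have hle : ∀ i, Nat.find (hex i) < R + 1 := by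
    intro i
    apply Nat.lt_succ_of_le
    apply Nat.find_min'
    intro j j'
    rw [Nat.div_eq_of_lt (X i j).2, Nat.div_eq_of_lt (X i j').2]
  have hsp := fun i => Nat.find_spec (hex i)
  let j0 : Fin l := ⟨0, hl⟩
  have hne : ∀ i i', i < i' → nd ⟨Nat.find (hex i), hle i⟩ (X i j0) ≠
      nd ⟨Nat.find (hex i'), hle i'⟩ (X i' j0) := by
    intro i i' hii heq
    simp only [nd, Prod.mk.injEq, Fin.mk.injEq] at heq
    obtain ⟨h1, h2⟩ := heq
    have m1 : ∀ u < Nat.find (hex i), _ := fun u hu => Nat.find_min (hex i) hu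
    have m2 : ∀ u < Nat.find (hex i'), _ := fun u hu => Nat.find_min (hex i') hu
    have s1 := hsp i
    have s2 := hsp i'
    rw [← h1] at m2 s2 h2
    generalize Nat.find (hex i) = s at *
    cases s with
    | zero =>
      have := hX i i' j0 j0 hii
      rw [Fin.lt_def] at this
      simp at h2
      omega
    | succ u =>
      have c1 := m1 u (by omega)
      have c2 := m2 u (by omega)
      push Not at c1 c2
      obtain ⟨p, p', hp⟩ := c1
      obtain ⟨q, q', hq⟩ := c2
      have mono : ∀ x y, (X i x : ℕ) / 2 ^ u ≤ (X i' y : ℕ) / 2 ^ u := fun x y =>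
        Nat.div_le_div_right (le_of_lt (hX i i' x y hii))
      have e1 := s1 p p'
      have e2 := s2 q q'
      have e3 := s1 p j0
      have e4 := s2 q j0
      simp only [pow_succ, ← Nat.div_div_eq_div_mul] at e1 e2 e3 e4 h2
      have := mono p q
      have := mono p q'
      have := mono p' q
      have := mono p' q'
      omega
  refine ⟨fun i => nd ⟨Nat.find (hex i), hle i⟩ (X i j0), ?_, ?_⟩
  · intro i i' h
    rcases lt_trichotomy i i' with h' | h' | h'
    · exact absurd h (hne i i' h')
    · exact h'
    · exact absurd h.symm (hne i' i h')
  · intro i j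
    refine ⟨⟨Nat.find (hex i), hle i⟩, ?_⟩
    simp only [nd, Prod.mk.injEq, Fin.mk.injEq, true_and]
    exact hsp i j0 j

theorem count_fun {P : Type*} [Fintype P] [DecidableEq P] (M : ℕ) [NeZero M] (S : Finset P) :
    ((Finset.univ.filter fun F : P → Fin M => ∀ p ∈ S, F p ≠ 0).card : ℝ) =
      (M : ℝ) ^ (Fintype.card P) * (1 - 1 / (M : ℝ)) ^ S.card := by
  classical
  have hM : (M : ℝ) ≠ 0 := by exact_mod_cast NeZero.ne M
  have hM1 : 1 ≤ M := Nat.one_le_iff_ne_zero.2 (NeZero.ne M)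
  have : (Finset.univ.filter fun F : P → Fin M => ∀ p ∈ S, F p ≠ 0) =
      Fintype.piFinset fun p => if p ∈ S then Finset.univ.erase (0 : Fin M) else Finset.univ := by
    ext F
    simp only [Finset.mem_filter, Finset.mem_univ, true_and, Fintype.mem_piFinset]
    apply forall_congr'
    intro p
    by_cases hp : p ∈ S <;> simp [hp]
  rw [this, Fintype.card_piFinset, Nat.cast_prod]
  have h2 : ∀ p : P, (((if p ∈ S then Finset.univ.erase (0 : Fin M) else Finset.univ).card : ℕ) : ℝ)
      = (M : ℝ) * (if p ∈ S then (1 - 1 / (M : ℝ)) else 1) := by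
    intro p
    by_cases hp : p ∈ S
    · simp only [hp, if_true]
      rw [Finset.card_erase_of_mem (Finset.mem_univ _), Finset.card_univ, Fintype.card_fin,
        Nat.cast_sub hM1]
      field_simp
      simp
    · simp [hp]
  rw [Finset.prod_congr rfl fun p _ => h2 p, Finset.prod_mul_distrib]
  congr 1
  · simp
  · rw [Finset.prod_ite_mem]; simp

open Classical in
noncomputable def fox {R M : ℕ} [NeZero M] (F : Nd R × Nd R → Fin M) :
    Finset (Fin (2 ^ R) × Fin (2 ^ R)) :=
  Finset.univ.filter fun p => ∀ s t, F (nd s p.1, nd t p.2) ≠ 0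

def toNN {m n : ℕ} (p : Fin m × Fin n) : ℕ × ℕ := (p.1, p.2)

theorem toNN_inj {m n : ℕ} : Function.Injective (toNN : Fin m × Fin n → ℕ × ℕ) := by
  rintro ⟨a, b⟩ ⟨c, d⟩ h
  simp only [toNN, Prod.mk.injEq] at h
  exact Prod.ext (Fin.ext h.1) (Fin.ext h.2)

theorem fox_bad {R M l : ℕ} [NeZero M] (hl : 0 < l) (F : Nd R × Nd R → Fin M)
    (h : HasJ l ((fox F).image toNN : Finset (ℕ × ℕ))) :
    ∃ a b : Fin l → Nd R, Function.Injective a ∧ Function.Injective b ∧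
      ∀ i j, F (a i, b j) ≠ 0 := by
  obtain ⟨e, h1, h2, h3⟩ := h
  have : ∀ i j : Fin l, ∃ p ∈ fox F, toNN p = e i j := fun i j => by
    simpa using h1 i j i.2 j.2
  choose X hX hXe using this
  have e1 : ∀ i j, ((X i j).1 : ℕ) = (e i j).1 := fun i j => by rw [← hXe]; rfl
  have e2 : ∀ i j, ((X i j).2 : ℕ) = (e i j).2 := fun i j => by rw [← hXe]; rfl
  obtain ⟨a, ha, ha'⟩ := exists_nodes R l hl (fun i j => (X i j).1) (by
    intro i i' j j' hii
    rw [Fin.lt_def, e1, e1]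
    exact h2 _ _ _ _ hii i'.2 j.2 j'.2)
  obtain ⟨b, hb, hb'⟩ := exists_nodes R l hl (fun j i => (X i j).2) (by
    intro j j' i i' hii
    rw [Fin.lt_def, e2, e2]
    exact h3 _ _ _ _ hii j'.2 i.2 i'.2)
  refine ⟨a, b, ha, hb, fun i j => ?_⟩
  obtain ⟨s, hs⟩ := ha' i j
  obtain ⟨t, ht⟩ := hb' j i
  rw [hs, ht]
  have := hX i j
  simp only [fox, Finset.mem_filter, Finset.mem_univ, true_and] at this
  exact this s t

theorem fox_main (R : ℕ) : ∃ S : Finset (ℕ × ℕ),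
    S ⊆ Finset.range (2 ^ R) ×ˢ Finset.range (2 ^ R) ∧
    ¬ HasJ (20 * (R + 1) ^ 2) (S : Set (ℕ × ℕ)) ∧
    ((2 : ℝ) ^ R) ^ 2 * (3 / 4) ^ (R + 1) / 2 ≤ (S.card : ℝ) := by
  classical
  set Q := R + 1 with hQ
  set M := 4 * Q with hM
  have : NeZero M := ⟨by omega⟩
  set l := 20 * Q ^ 2 with hl
  have hlpos : 0 < l := by positivity
  have hQR : (1 : ℝ) ≤ Q := by exact_mod_cast (by omega : 1 ≤ Q)
  have hMR : (M : ℝ) = 4 * Q := by rw [hM]; push_cast; ring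
  set q : ℝ := 1 - 1 / (M : ℝ) with hq
  have hM4 : (4 : ℝ) ≤ M := by rw [hMR]; linarith
  have hq0 : 0 ≤ q := by
    rw [hq, sub_nonneg, div_le_one (by linarith)]; linarith
  set W : ℝ := (M : ℝ) ^ (Fintype.card (Nd R × Nd R)) with hW
  have hW0 : 0 < W := by positivity
  set δ : ℝ := (3 / 4 : ℝ) ^ Q with hδ
  have hδ0 : 0 < δ := by positivity
  have hδq : δ ≤ q ^ (Q ^ 2) := by
    rw [sq, pow_mul, hδ]
    apply pow_le_pow_left₀ (by norm_num)
    have := one_add_mul_le_pow (a := -(1 / (M : ℝ))) (by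
      have : 1 / (M : ℝ) ≤ 1 := by rw [div_le_one (by linarith)]; linarith
      linarith) Q
    rw [← sub_eq_add_neg, ← hq] at this
    refine le_trans (le_of_eq ?_) this
    rw [hMR]; field_simp; norm_num
  -- bad functions
  have hqM : q ^ M ≤ 1 / 2 := by
    have h1 : q ≤ Real.exp (-(1 / (M : ℝ))) := by
      have := Real.add_one_le_exp (-(1 / (M : ℝ)))
      linarith
    calc q ^ M ≤ Real.exp (-(1 / (M : ℝ))) ^ M := pow_le_pow_left₀ hq0 h1 _
      _ = Real.exp (-1) := by
        rw [← Real.exp_nat_mul]; congr 1; field_simp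
      _ ≤ 1 / 2 := by
        rw [Real.exp_neg, one_div]
        apply inv_anti₀ (by norm_num)
        have := Real.add_one_le_exp (1 : ℝ)
        linarith
  let bad := Finset.univ.filter fun F : Nd R × Nd R → Fin M =>
    HasJ l ((fox F).image toNN : Finset (ℕ × ℕ))
  have hbad : (bad.card : ℝ) ≤ W * (δ / 4) := by
    let I := Finset.univ.filter fun ab : (Fin l → Nd R) × (Fin l → Nd R) =>
      Function.Injective ab.1 ∧ Function.Injective ab.2
    let Sab : (Fin l → Nd R) × (Fin l → Nd R) → Finset (Nd R × Nd R) := fun ab =>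
      (Finset.univ : Finset (Fin l × Fin l)).image fun ij => (ab.1 ij.1, ab.2 ij.2)
    have hsub : bad ⊆ I.biUnion fun ab =>
        Finset.univ.filter fun F : Nd R × Nd R → Fin M => ∀ p ∈ Sab ab, F p ≠ 0 := by
      intro F hF
      obtain ⟨a, b, ha, hb, hab⟩ := fox_bad hlpos F (Finset.mem_filter.1 hF).2
      simp only [Finset.mem_biUnion, Finset.mem_filter, Finset.mem_univ, true_and, I]
      refine ⟨(a, b), ⟨ha, hb⟩, ?_⟩
      intro p hp
      obtain ⟨ij, -, rfl⟩ := Finset.mem_image.1 hp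
      exact hab _ _
    have hcS : ∀ ab ∈ I, (Sab ab).card = l * l := by
      intro ab hab
      have hab' := (Finset.mem_filter.1 hab).2
      rw [Finset.card_image_of_injective]
      · simp
      · rintro ⟨i, j⟩ ⟨i', j'⟩ h
        simp only [Prod.mk.injEq] at h
        exact Prod.ext (hab'.1 h.1) (hab'.2 h.2)
    have hIc : (I.card : ℝ) ≤ 2 ^ (4 * Q * l) := by
      have h1 : I.card ≤ (Q * 2 ^ R) ^ l * (Q * 2 ^ R) ^ l := by
        refine (Finset.card_le_univ _).trans (le_of_eq ?_)
        simp [hQ]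
      have h2 : Q * 2 ^ R ≤ 2 ^ (2 * Q) := by
        have h3 : Q ≤ 2 ^ Q := Nat.lt_two_pow_self.le
        have h4 : 2 ^ R ≤ 2 ^ Q := Nat.pow_le_pow_right (by norm_num) (by omega)
        calc _ ≤ 2 ^ Q * 2 ^ Q := Nat.mul_le_mul h3 h4
          _ = 2 ^ (Q + Q) := (pow_add 2 Q Q).symm
          _ = _ := by rw [two_mul]
      have h5 : I.card ≤ 2 ^ (4 * Q * l) := by
        refine h1.trans ?_
        calc _ ≤ (2 ^ (2 * Q)) ^ l * (2 ^ (2 * Q)) ^ l :=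
              Nat.mul_le_mul (Nat.pow_le_pow_left h2 l) (Nat.pow_le_pow_left h2 l)
          _ = _ := by rw [← pow_mul, ← pow_add]; congr 1; ring
      exact_mod_cast h5
    have hql : q ^ (l * l) ≤ (1 / 2) ^ (5 * Q * l) := by
      have : l * l = M * (5 * Q * l) := by rw [hM]; nth_rewrite 1 [hl]; ring
      rw [this, pow_mul]
      exact pow_le_pow_left₀ (by positivity) hqM _
    calc (bad.card : ℝ) ≤ _ := Nat.cast_le.2 (Finset.card_le_card hsub)
      _ ≤ _ := Nat.cast_le.2 Finset.card_biUnion_le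
      _ = ∑ ab ∈ I, W * q ^ (l * l) := by
          rw [Nat.cast_sum]
          apply Finset.sum_congr rfl
          intro ab hab
          rw [count_fun, hcS ab hab]
      _ = (I.card : ℝ) * (W * q ^ (l * l)) := by rw [Finset.sum_const, nsmul_eq_mul]
      _ ≤ 2 ^ (4 * Q * l) * (W * (1 / 2) ^ (5 * Q * l)) := by gcongr
      _ = W * (1 / 2) ^ (Q * l) := by
          have : 5 * Q * l = 4 * Q * l + Q * l := by ring
          rw [this, pow_add (1 / 2 : ℝ)]
          have h2 : (2 : ℝ) ^ (4 * Q * l) * (1 / 2) ^ (4 * Q * l) = 1 := by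
            rw [← mul_pow]; norm_num
          linear_combination (W * (1 / 2) ^ (Q * l)) * h2
      _ ≤ W * (δ / 4) := by
          apply mul_le_mul_of_nonneg_left _ hW0.le
          have h1 : (1 / 2 : ℝ) ^ (Q * l) ≤ (1 / 2) ^ (Q + 2) := by
            apply pow_le_pow_of_le_one (by norm_num) (by norm_num)
            have : 20 ≤ l := by rw [hl]; nlinarith [Nat.one_le_pow 2 Q (by omega)]
            nlinarith [show 1 ≤ Q by omega]
          have h2 : (1 / 2 : ℝ) ^ Q ≤ δ := pow_le_pow_left₀ (by norm_num) (by norm_num) _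
          rw [pow_add] at h1
          norm_num at h1 h2 ⊢
          linarith
  have htot : ∑ F : Nd R × Nd R → Fin M, ((fox F).card : ℝ) = ((2 : ℝ) ^ R) ^ 2 * (W * q ^ (Q ^ 2)) := by
    have h1 : ∀ F : Nd R × Nd R → Fin M, ((fox F).card : ℝ) =
        ∑ p : Fin (2 ^ R) × Fin (2 ^ R), if ∀ s t, F (nd s p.1, nd t p.2) ≠ 0 then (1 : ℝ) else 0 := by
      intro F
      rw [fox, Finset.card_filter]
      push_cast
      rfl
    rw [Finset.sum_congr rfl fun F _ => h1 F, Finset.sum_comm]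
    have h2 : ∀ p : Fin (2 ^ R) × Fin (2 ^ R), (∑ F : Nd R × Nd R → Fin M,
        if ∀ s t, F (nd s p.1, nd t p.2) ≠ 0 then (1 : ℝ) else 0) = W * q ^ (Q ^ 2) := by
      intro p
      have h3 := count_fun (P := Nd R × Nd R) M
        ((Finset.univ : Finset (Fin (R + 1) × Fin (R + 1))).image fun st => (nd st.1 p.1, nd st.2 p.2))
      rw [Finset.card_image_of_injective] at h3
      · rw [Finset.sum_boole]
        have h4 : (Finset.univ : Finset (Fin (R + 1) × Fin (R + 1))).card = Q ^ 2 := by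
          simp [hQ, sq]
        rw [h4] at h3
        rw [← h3]
        congr 2
        ext F
        simp only [Finset.mem_filter, Finset.mem_univ, true_and, Finset.forall_mem_image,
          forall_true_left, Prod.forall]
      · rintro ⟨i, j⟩ ⟨i', j'⟩ h
        simp only [nd, Prod.mk.injEq] at h
        exact Prod.ext h.1.1 h.2.1
    rw [Finset.sum_congr rfl fun p _ => h2 p, Finset.sum_const, nsmul_eq_mul]
    simp [sq]
  by_contra hcon
  push Not at hcon
  have hN : ∀ F : Nd R × Nd R → Fin M, ((fox F).card : ℝ) ≤ ((2 : ℝ) ^ R) ^ 2 := by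
    intro F
    have : (fox F).card ≤ (2 ^ R) ^ 2 := by
      refine (Finset.card_le_univ _).trans (le_of_eq ?_)
      simp [sq]
    exact_mod_cast this
  have hall : ∀ F : Nd R × Nd R → Fin M, ((fox F).card : ℝ) ≤
      ((2 : ℝ) ^ R) ^ 2 * δ / 2 + if F ∈ bad then ((2 : ℝ) ^ R) ^ 2 else 0 := by
    intro F
    by_cases hF : F ∈ bad
    · rw [if_pos hF]
      have := hN F
      have : 0 ≤ ((2 : ℝ) ^ R) ^ 2 * δ / 2 := by positivity
      linarith
    · rw [if_neg hF, add_zero]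
      have hF' : ¬ HasJ l ((fox F).image toNN : Finset (ℕ × ℕ)) := fun h =>
        hF (Finset.mem_filter.2 ⟨Finset.mem_univ _, h⟩)
      have := hcon ((fox F).image toNN) ?_ hF'
      · rw [Finset.card_image_of_injective _ toNN_inj] at this
        exact this.le
      · intro p hp
        obtain ⟨q, -, rfl⟩ := Finset.mem_image.1 hp
        simp [toNN]
  have hsum := Finset.sum_le_sum fun (F : Nd R × Nd R → Fin M) (_ : F ∈ Finset.univ) => hall F
  rw [htot, Finset.sum_add_distrib, Finset.sum_const, ← Finset.sum_filter, Finset.sum_const,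
    nsmul_eq_mul, nsmul_eq_mul] at hsum
  have hcu : (((Finset.univ : Finset (Nd R × Nd R → Fin M)).card : ℕ) : ℝ) = W := by
    rw [Finset.card_univ, Fintype.card_fun, Fintype.card_fin, hW]; push_cast; rfl
  have hfb : (Finset.univ.filter fun F => F ∈ bad) = bad := by ext; simp
  rw [hcu, hfb] at hsum
  set N2 : ℝ := ((2 : ℝ) ^ R) ^ 2 with hN2
  have hN20 : 0 < N2 := by positivity
  have k1 : N2 * (W * δ) ≤ N2 * (W * q ^ (Q ^ 2)) := by gcongr
  have k2 : (bad.card : ℝ) * N2 ≤ W * (δ / 4) * N2 := by gcongr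
  have k3 : 0 < N2 * (W * δ) := by positivity
  nlinarith
theorem diag_main (N l n : ℕ) (hN : 0 < N) (S : Finset (ℕ × ℕ))
    (hS : S ⊆ Finset.range N ×ˢ Finset.range N) (h : ¬ HasJ l (S : Set (ℕ × ℕ))) :
    ∃ S' : Finset (ℕ × ℕ), S' ⊆ Finset.range n ×ˢ Finset.range n ∧
      ¬ HasJ (l + 1) (S' : Set (ℕ × ℕ)) ∧ S'.card = n / N * S.card := by
  classical
  have hlt : ∀ p ∈ S, p.1 < N ∧ p.2 < N := by
    intro p hp
    have := hS hp
    simpa using this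
  have dm : ∀ t x, x < N → (t * N + x) / N = t ∧ (t * N + x) % N = x := by
    intro t x hx
    constructor
    · rw [mul_comm, Nat.mul_add_div hN, Nat.div_eq_of_lt hx, add_zero]
    · rw [mul_comm, Nat.mul_add_mod, Nat.mod_eq_of_lt hx]
  refine ⟨(Finset.range (n / N) ×ˢ S).image fun q => (q.1 * N + q.2.1, q.1 * N + q.2.2), ?_, ?_, ?_⟩
  · intro p hp
    obtain ⟨⟨t, x, y⟩, hq, rfl⟩ := Finset.mem_image.1 hp
    simp only [Finset.mem_product, Finset.mem_range] at hq ⊢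
    obtain ⟨ht, hxy⟩ := hq
    have := hlt _ hxy
    have h1 : (t + 1) * N ≤ n := le_trans (Nat.mul_le_mul_right N ht) (Nat.div_mul_le_self n N)
    rw [add_mul, one_mul] at h1
    simp only at this
    omega
  · rintro ⟨e, h1, h2, h3⟩
    apply h
    have hp : ∀ i j, i < l + 1 → j < l + 1 → (e i j).1 / N = (e i j).2 / N ∧
        ((e i j).1 % N, (e i j).2 % N) ∈ S := by
      intro i j hi hj
      have := h1 i j hi hj
      rw [Finset.mem_coe, Finset.mem_image] at this
      obtain ⟨⟨t, x, y⟩, hq, he⟩ := this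
      simp only [Finset.mem_product, Finset.mem_range] at hq
      have hxy := hlt _ hq.2
      rw [← he]
      simp only at hxy ⊢
      rw [(dm t x hxy.1).1, (dm t y hxy.2).1, (dm t x hxy.1).2, (dm t y hxy.2).2]
      exact ⟨rfl, hq.2⟩
    have ht : ∀ i j, i < l → j < l → (e (i + 1) j).1 / N = (e 0 l).1 / N ∧
        (e (i + 1) j).2 / N = (e 0 l).1 / N := by
      intro i j hi hj
      have a1 := (hp (i + 1) j (by omega) (by omega)).1
      have a2 := (hp 0 l (by omega) (by omega)).1
      have b1 := Nat.div_le_div_right (c := N)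
        (h2 0 (i + 1) l j (by omega) (by omega) (by omega) (by omega)).le
      have b2 := Nat.div_le_div_right (c := N)
        (h3 (i + 1) 0 j l (by omega) (by omega) (by omega) (by omega)).le
      omega
    refine ⟨fun i j => ((e (i + 1) j).1 % N, (e (i + 1) j).2 % N), ?_, ?_, ?_⟩
    · intro i j hi hj
      exact (hp (i + 1) j (by omega) (by omega)).2
    · intro i i' j j' a b c d
      have h4 := h2 (i + 1) (i' + 1) j j' (by omega) (by omega) (by omega) (by omega)
      rw [← Nat.div_add_mod (e (i + 1) j).1 N, ← Nat.div_add_mod (e (i' + 1) j').1 N,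
        (ht i j (by omega) c).1, (ht i' j' b d).1] at h4
      simp only
      omega
    · intro i i' j j' a b c d
      have h4 := h3 (i + 1) (i' + 1) j j' (by omega) (by omega) (by omega) (by omega)
      rw [← Nat.div_add_mod (e (i + 1) j).2 N, ← Nat.div_add_mod (e (i' + 1) j').2 N,
        (ht i j c (by omega)).2, (ht i' j' d b).2] at h4
      simp only
      omega
  · rw [Finset.card_image_of_injOn, Finset.card_product, Finset.card_range]
    rintro ⟨t, x, y⟩ hq ⟨t', x', y'⟩ hq' heq
    simp only [Finset.coe_product, Set.mem_prod, Finset.mem_coe] at hq hq'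
    have a := hlt _ hq.2
    have a' := hlt _ hq'.2
    simp only [Prod.mk.injEq] at heq a a' ⊢
    have b1 := dm t x a.1
    have b2 := dm t y a.2
    rw [heq.1] at b1
    rw [heq.2] at b2
    have b1' := dm t' x' a'.1
    have b2' := dm t' y' a'.2
    omega
theorem two_pow_bound (R : ℕ) (hR : 24 ≤ R) :
    (2 : ℝ) ^ ((R : ℝ) / 4) ≤ (3 / 16) * (3 / 2) ^ R := by
  have h1 : (2 : ℝ) ^ ((1 : ℝ) / 4) ≤ 5 / 4 := by
    calc (2 : ℝ) ^ ((1 : ℝ) / 4) ≤ ((5 / 4 : ℝ) ^ (4 : ℕ)) ^ ((1 : ℝ) / 4) :=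
          Real.rpow_le_rpow (by norm_num) (by norm_num) (by norm_num)
      _ = 5 / 4 := by
          rw [← Real.rpow_natCast, ← Real.rpow_mul (by norm_num)]; norm_num
  have h2 : (2 : ℝ) ^ ((R : ℝ) / 4) = ((2 : ℝ) ^ ((1 : ℝ) / 4)) ^ R := by
    rw [← Real.rpow_natCast, ← Real.rpow_mul (by norm_num)]; congr 1; ring
  have h3 : (16 / 3 : ℝ) ≤ (6 / 5) ^ R := by
    have := one_add_mul_le_pow (a := (1 / 5 : ℝ)) (by norm_num) R
    have hR' : (24 : ℝ) ≤ R := by exact_mod_cast hR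
    norm_num at this
    linarith
  have h4 : (3 / 2 : ℝ) ^ R = (5 / 4) ^ R * (6 / 5) ^ R := by rw [← mul_pow]; norm_num
  rw [h2, h4]
  calc _ ≤ (5 / 4 : ℝ) ^ R := pow_le_pow_left₀ (by positivity) h1 R
    _ = (3 / 16) * ((5 / 4 : ℝ) ^ R * (16 / 3)) := by ring
    _ ≤ _ := by gcongr

theorem num_tendsto : Tendsto (fun k : ℕ => ((k : ℝ) / Real.logb 2 (k : ℝ)) ^ ((1 : ℝ) / 4))
    atTop atTop := by
  apply (tendsto_rpow_atTop (by norm_num : (0 : ℝ) < 1 / 4)).comp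
  have h1 : Tendsto (fun x : ℝ => x / Real.log x) atTop atTop := by
    have h := Real.isLittleO_log_id_atTop.tendsto_div_nhds_zero
    have h2 : Tendsto (fun x : ℝ => Real.log x / id x) atTop (nhdsWithin 0 (Set.Ioi 0)) := by
      rw [tendsto_nhdsWithin_iff]
      refine ⟨h, ?_⟩
      filter_upwards [eventually_gt_atTop 1] with x hx
      exact div_pos (Real.log_pos hx) (by simp only [id]; linarith)
    have h3 := h2.inv_tendsto_nhdsGT_zero
    refine h3.congr fun x => ?_
    simp
  have h2 : Tendsto (fun x : ℝ => x / Real.logb 2 x) atTop atTop := by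
    have := h1.const_mul_atTop (Real.log_pos (by norm_num : (1 : ℝ) < 2))
    refine this.congr fun x => ?_
    rw [Real.logb, div_div_eq_mul_div]; ring
  exact h2.comp tendsto_natCast_atTop_atTop

theorem num_main (ε : ℝ) (hε : 0 < ε) : ∃ K : ℕ, ∀ k : ℕ, K ≤ k → 0 < k ∧ ∃ R w : ℕ, 0 < w ∧
    (20 * (R + 1) ^ 2 + 1) * w ≤ k ∧
    ((20 * (R + 1) ^ 2 + 1 : ℕ) : ℝ) ^ 2 * (1 - (w : ℝ) / k) ^ w ≤ ε ∧
    (2 : ℝ) ^ ((1 / 160) * ((k : ℝ) / Real.logb 2 (k : ℝ)) ^ ((1 : ℝ) / 4)) ≤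
      (3 / 16) * (3 / 2) ^ R := by
  have ev := ((num_tendsto.eventually_ge_atTop 480).and
    ((tendsto_natCast_atTop_atTop (R := ℝ)).eventually_ge_atTop (1 / ε))).and
    (eventually_ge_atTop 2)
  obtain ⟨K, hK⟩ := eventually_atTop.1 ev
  refine ⟨K, fun k hk => ?_⟩
  obtain ⟨⟨hx, hkε⟩, hk2⟩ := hK k hk
  set L := Real.logb 2 (k : ℝ) with hL
  set x := ((k : ℝ) / L) ^ ((1 : ℝ) / 4) with hxdef
  have hk2' : (2 : ℝ) ≤ k := by exact_mod_cast hk2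
  have hk0 : (0 : ℝ) < k := by linarith
  have hlogk : 0 < Real.log k := Real.log_pos (by linarith)
  have hL1 : 1 ≤ L := by
    rw [hL, Real.le_logb_iff_rpow_le (by norm_num) hk0]; simpa using hk2'
  have hLlog : Real.log k ≤ L := by
    have hl2 : Real.log 2 ≤ 1 := by
      have := Real.log_two_lt_d9; linarith
    have hl2' : 0 < Real.log 2 := Real.log_pos (by norm_num)
    rw [hL, Real.logb, le_div_iff₀ hl2']
    nlinarith
  have hx4 : x ^ 4 = k / L := by
    rw [hxdef, ← Real.rpow_natCast, ← Real.rpow_mul (by positivity)]; norm_num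
  set R := ⌊x / 20⌋₊ with hR
  have hR1 : (R : ℝ) ≤ x / 20 := Nat.floor_le (by positivity)
  have hR2 : x / 20 < R + 1 := Nat.lt_floor_add_one _
  have hR24 : 24 ≤ R := Nat.le_floor (by push_cast; linarith)
  have hR24' : (24 : ℝ) ≤ R := by exact_mod_cast hR24
  set l := 20 * (R + 1) ^ 2 + 1 with hl
  have hlR : (l : ℝ) = 20 * ((R : ℝ) + 1) ^ 2 + 1 := by rw [hl]; push_cast; ring
  have hl1 : (l : ℝ) ≤ x ^ 2 / 16 := by
    have : (R : ℝ) ^ 2 ≤ (x / 20) ^ 2 := pow_le_pow_left₀ (by positivity) hR1 2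
    rw [hlR]; nlinarith
  have hl2 : (2 : ℝ) ≤ l := by rw [hlR]; nlinarith
  have hl0 : (0 : ℝ) < l := by linarith
  have hlsq : (l : ℝ) ^ 2 * (256 * L) ≤ k := by
    have h1 : (l : ℝ) ^ 2 ≤ (x ^ 2 / 16) ^ 2 := pow_le_pow_left₀ (by positivity) hl1 2
    have h2 : (x ^ 2 / 16) ^ 2 = (k / L) / 256 := by rw [← hx4]; ring
    rw [h2] at h1
    calc (l : ℝ) ^ 2 * (256 * L) ≤ (k / L) / 256 * (256 * L) := by gcongr
      _ = k := by field_simp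
  have hlsq' : (l : ℝ) ^ 2 ≤ k := by nlinarith [sq_nonneg (l : ℝ)]
  have h2l : 2 * (l : ℝ) ≤ k := by nlinarith
  have hlpos : 0 < l := by omega
  set w := k / l with hw
  have hw1 : (k : ℝ) / l < w + 1 := by
    rw [div_lt_iff₀ hl0]
    have : k < (k / l + 1) * l := by
      have := Nat.lt_div_mul_add (a := k) hlpos
      rw [add_mul, one_mul]; exact this
    rw [← hw] at this
    exact_mod_cast this
  have hkl : 2 ≤ (k : ℝ) / l := by rw [le_div_iff₀ hl0]; exact h2l
  have hw2 : (k : ℝ) / (2 * l) ≤ w := by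
    have : (k : ℝ) / (2 * l) = (k / l) / 2 := by field_simp
    rw [this]; linarith
  have hw0 : (0 : ℝ) < w := by linarith
  have hwk : l * w ≤ k := Nat.mul_div_le k l
  have hwk' : (w : ℝ) ≤ k := by exact_mod_cast Nat.div_le_self k l
  refine ⟨by omega, R, w, by exact_mod_cast hw0, hwk, ?_, ?_⟩
  · have h1 : (1 - (w : ℝ) / k) ^ w ≤ Real.exp (-(2 * Real.log k)) := by
      have h0 : 0 ≤ 1 - (w : ℝ) / k := by
        rw [sub_nonneg, div_le_one hk0]; exact hwk'
      have h2 : 1 - (w : ℝ) / k ≤ Real.exp (-((w : ℝ) / k)) := by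
        have := Real.add_one_le_exp (-((w : ℝ) / k)); linarith
      calc _ ≤ Real.exp (-((w : ℝ) / k)) ^ w := pow_le_pow_left₀ h0 h2 w
        _ = Real.exp (-((w : ℝ) ^ 2 / k)) := by
            rw [← Real.exp_nat_mul]; congr 1; ring
        _ ≤ _ := by
            apply Real.exp_le_exp.2
            apply neg_le_neg
            have h3 : ((k : ℝ) / (2 * l)) ^ 2 ≤ (w : ℝ) ^ 2 :=
              pow_le_pow_left₀ (by positivity) hw2 2
            have h4 : ((k : ℝ) / (2 * l)) ^ 2 / k = k / (4 * l ^ 2) := by field_simp; norm_num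
            have h5 : 2 * Real.log k ≤ k / (4 * l ^ 2) := by
              rw [le_div_iff₀ (by positivity)]
              have : Real.log k * (l : ℝ) ^ 2 ≤ L * l ^ 2 := by gcongr
              have : 0 ≤ L * (l : ℝ) ^ 2 := by positivity
              nlinarith
            calc _ ≤ _ := h5
              _ = _ := h4.symm
              _ ≤ _ := by gcongr
    have h6 : Real.exp (-(2 * Real.log k)) = 1 / (k : ℝ) ^ 2 := by
      have : 2 * Real.log k = Real.log ((k : ℝ) ^ 2) := by rw [Real.log_pow]; norm_num
      rw [this, Real.exp_neg, Real.exp_log (by positivity), one_div]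
    rw [h6] at h1
    calc (l : ℝ) ^ 2 * (1 - (w : ℝ) / k) ^ w ≤ (k : ℝ) * (1 / (k : ℝ) ^ 2) := by
          apply mul_le_mul hlsq' h1 _ hk0.le
          apply pow_nonneg
          rw [sub_nonneg, div_le_one hk0]; exact hwk'
      _ = 1 / (k : ℝ) := by field_simp
      _ ≤ ε := by
          rw [div_le_iff₀ hk0]
          rw [div_le_iff₀ hε] at hkε
          linarith
  · refine le_trans ?_ (two_pow_bound R hR24)
    apply Real.rpow_le_rpow_of_exponent_le (by norm_num)
    linarith

open Classical in
noncomputable def matSet {n : ℕ} (A : Fin n → Fin n → Bool) : Finset (ℕ × ℕ) :=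
  (Finset.univ.filter fun p : Fin n × Fin n => A p.1 p.2 = true).image toNN

theorem matSet_card {n : ℕ} (A : Fin n → Fin n → Bool) : (matSet A).card = mass A :=
  Finset.card_image_of_injective _ toNN_inj

theorem matSet_sub {n : ℕ} (A : Fin n → Fin n → Bool) :
    matSet A ⊆ Finset.range n ×ˢ Finset.range n := by
  intro p hp
  obtain ⟨q, -, rfl⟩ := Finset.mem_image.1 hp
  simp [toNN]

theorem mem_matSet {n : ℕ} (A : Fin n → Fin n → Bool) (p : ℕ × ℕ) :
    p ∈ matSet A ↔ ∃ i j : Fin n, A i j = true ∧ p = ((i : ℕ), (j : ℕ)) := by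
  simp only [matSet, Finset.mem_image, Finset.mem_filter, Finset.mem_univ, true_and, toNN]
  constructor
  · rintro ⟨q, h1, rfl⟩; exact ⟨_, _, h1, rfl⟩
  · rintro ⟨i, j, h1, rfl⟩; exact ⟨(i, j), h1, rfl⟩

theorem contains_hasJ {k n l : ℕ} (A : Fin n → Fin n → Bool) (π : Equiv.Perm (Fin k))
    (h : ContainsMat (permMatrix π) A) (hJ : HasJ l (pset π)) :
    HasJ l (matSet A : Set (ℕ × ℕ)) := by
  obtain ⟨r, c, hr, hc, h⟩ := h
  obtain ⟨e, h1, h2, h3⟩ := hJ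
  have : ∀ i j, ∃ x : ℕ × ℕ, i < l → j < l → ∃ a : Fin k, e i j = ((a : ℕ), (π a : ℕ)) ∧
      x = ((r a : ℕ), (c (π a) : ℕ)) := by
    intro i j
    by_cases hi : i < l
    · by_cases hj : j < l
      · obtain ⟨a, ha⟩ := h1 i j hi hj
        exact ⟨_, fun _ _ => ⟨a, ha, rfl⟩⟩
      · exact ⟨(0,0), fun _ h => absurd h hj⟩
    · exact ⟨(0,0), fun h => absurd h hi⟩
  choose f hf using this
  refine ⟨f, ?_, ?_, ?_⟩
  · intro i j hi hj
    obtain ⟨a, -, ha⟩ := hf i j hi hj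
    rw [Finset.mem_coe, mem_matSet]
    exact ⟨_, _, h a (π a) (by simp [permMatrix]), ha⟩
  · intro i i' j j' p q s t
    obtain ⟨a, ha1, ha2⟩ := hf i j (by omega) s
    obtain ⟨b, hb1, hb2⟩ := hf i' j' q t
    have := h2 i i' j j' p q s t
    rw [ha1, hb1] at this
    rw [ha2, hb2]
    exact hr (Fin.lt_def.2 this)
  · intro i i' j j' p q s t
    obtain ⟨a, ha1, ha2⟩ := hf i j s (by omega)
    obtain ⟨b, hb1, hb2⟩ := hf i' j' t q
    have := h3 i i' j j' p q s t
    rw [ha1, hb1] at this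
    rw [ha2, hb2]
    exact hc (Fin.lt_def.2 this)

theorem hasJ_contains {k n : ℕ} (A : Fin n → Fin n → Bool) (π : Equiv.Perm (Fin k))
    (hJ : HasJ k (matSet A : Set (ℕ × ℕ))) : ContainsMat (permMatrix π) A := by
  obtain ⟨e, h1, h2, h3⟩ := hJ
  have : ∀ i j : Fin k, ∃ a b : Fin n, A a b = true ∧ e i j = ((a : ℕ), (b : ℕ)) := by
    intro i j
    have := h1 i j i.2 j.2
    rwa [Finset.mem_coe, mem_matSet] at this
  choose a b hA he using this
  refine ⟨fun i => a i (π i), fun j => b (π.symm j) j, ?_, ?_, ?_⟩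
  · intro i i' hii
    have := h2 i i' (π i) (π i') hii i'.2 (π i).2 (π i').2
    rw [he, he] at this
    exact Fin.lt_def.2 this
  · intro j j' hjj
    have := h3 (π.symm j) (π.symm j') j j' hjj j'.2 (π.symm j).2 (π.symm j').2
    rw [he, he] at this
    exact Fin.lt_def.2 this
  · intro i j hij
    simp only [permMatrix, decide_eq_true_eq] at hij
    subst hij
    simp only [Equiv.symm_apply_apply]
    exact hA _ _

theorem exU_lower {k l n : ℕ} (U : Finset (Equiv.Perm (Fin k))) (hU : ∀ π ∈ U, HasJ l (pset π))
    (S : Finset (ℕ × ℕ)) (hS : S ⊆ Finset.range n ×ˢ Finset.range n)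
    (h : ¬ HasJ l (S : Set (ℕ × ℕ))) : S.card ≤ exU n U := by
  classical
  let A : Fin n → Fin n → Bool := fun i j => decide (((i : ℕ), (j : ℕ)) ∈ S)
  have hA : matSet A = S := by
    ext p
    rw [mem_matSet]
    simp only [A, decide_eq_true_eq]
    constructor
    · rintro ⟨i, j, h, rfl⟩; exact h
    · intro hp
      have := hS hp
      simp only [Finset.mem_product, Finset.mem_range] at this
      exact ⟨⟨p.1, this.1⟩, ⟨p.2, this.2⟩, hp, rfl⟩
  apply le_csSup
  · refine ⟨n * n, ?_⟩
    rintro m ⟨B, -, rfl⟩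
    rw [← matSet_card]
    simpa using Finset.card_le_card (matSet_sub B)
  · refine ⟨A, ?_, by rw [← matSet_card, hA]⟩
    intro π hπ hc
    apply h
    rw [← hA]
    exact contains_hasJ A π hc (hU π hπ)

theorem exU_upper {k : ℕ} (U : Finset (Equiv.Perm (Fin k))) (hU : U.Nonempty) :
    ∃ C : ℕ, ∀ t : ℕ, exU ((k * k + 2) ^ t) U ≤ C * (k * k + 2) ^ t := by
  obtain ⟨C, hC⟩ := mt_main k
  obtain ⟨π, hπ⟩ := hU
  refine ⟨C, fun t => ?_⟩
  apply csSup_le'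
  rintro m ⟨A, hA, rfl⟩
  rw [← matSet_card]
  apply hC t _ (matSet_sub A)
  intro hJ
  exact hA π hπ (hasJ_contains A π hJ)

theorem cobdd {k : ℕ} (U : Finset (Equiv.Perm (Fin k))) (hU : U.Nonempty) :
    IsCoboundedUnder (· ≥ ·) atTop (fun n : ℕ => (exU n U : ℝ) / (n : ℝ)) := by
  obtain ⟨C, hC⟩ := exU_upper U hU
  refine ⟨C, fun a ha => ?_⟩
  rw [eventually_map, eventually_atTop] at ha
  obtain ⟨n0, hn0⟩ := ha
  have h1 : n0 ≤ (k * k + 2) ^ n0 := (Nat.lt_pow_self (by omega)).le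
  have h2 := hn0 _ h1
  have h3 : (exU ((k * k + 2) ^ n0) U : ℝ) ≤ C * (((k * k + 2) ^ n0 : ℕ) : ℝ) := by
    exact_mod_cast hC n0
  have hpos : (0 : ℝ) < (((k * k + 2) ^ n0 : ℕ) : ℝ) := by positivity
  have h4 := (div_le_iff₀ hpos).2 h3
  exact le_trans h2 h4
/-- There is an absolute constant `c > 0` such that for every
`0 < ε < 1` there exists `K` such that for every `k ≥ K` there is a set `U` of
`k`-permutations with `|U| ≥ (1−ε)·k!` and
`liminf_{n→∞} ex(n,U)/n ≥ 2^{c·(k/log₂ k)^{1/4}}`. -/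
theorem stmt9 :
    ∃ c : ℝ, 0 < c ∧ ∀ ε : ℝ, 0 < ε → ε < 1 → ∃ K : ℕ, ∀ k : ℕ, K ≤ k →
      ∃ U : Finset (Equiv.Perm (Fin k)),
        (1 - ε) * (Nat.factorial k : ℝ) ≤ (U.card : ℝ) ∧
        (2 : ℝ) ^ (c * ((k : ℝ) / Real.logb 2 (k : ℝ)) ^ ((1 : ℝ) / 4)) ≤
          liminf (fun n : ℕ => (exU n U : ℝ) / (n : ℝ)) atTop := by
  classical
  refine ⟨1 / 160, by norm_num, fun ε hε hε1 => ?_⟩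
  obtain ⟨K, hK⟩ := num_main ε hε
  refine ⟨K, fun k hk => ?_⟩
  obtain ⟨hk0, R, w, hw, hlw, hεb, hb⟩ := hK k hk
  set l := 20 * (R + 1) ^ 2 + 1 with hl
  have hfac : (0 : ℝ) < (k.factorial : ℝ) := by exact_mod_cast k.factorial_pos
  let U := Finset.univ.filter fun π : Equiv.Perm (Fin k) => HasJ l (pset π)
  have hUc : (1 - ε) * (Nat.factorial k : ℝ) ≤ (U.card : ℝ) := by
    have h1 := perm_good k l w hw hlw hk0
    refine le_trans ?_ (le_trans h1 (le_of_eq ?_))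
    · gcongr
    · simp only [U]
  have hUne : U.Nonempty := by
    apply Finset.card_pos.1
    have : (0 : ℝ) < (U.card : ℝ) := lt_of_lt_of_le (mul_pos (by linarith) hfac) hUc
    exact_mod_cast this
  refine ⟨U, hUc, hb.trans ?_⟩
  apply le_liminf_of_le (cobdd U hUne)
  obtain ⟨S, hS, hJ, hSc⟩ := fox_main R
  filter_upwards [eventually_ge_atTop (2 ^ R)] with n hn
  obtain ⟨S', hS', hJ', hc'⟩ := diag_main (2 ^ R) _ n (by positivity) S hS hJ
  have h1 := exU_lower U (fun π hπ => (Finset.mem_filter.1 hπ).2) S' hS' hJ'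
  have hNpos : 0 < 2 ^ R := by positivity
  have hnpos : (0 : ℝ) < n := by exact_mod_cast lt_of_lt_of_le hNpos hn
  have h2 : n ≤ 2 * (n / 2 ^ R * 2 ^ R) := by
    have a1 := Nat.lt_div_mul_add (a := n) hNpos
    have a2 : 1 ≤ n / 2 ^ R := (Nat.one_le_div_iff hNpos).2 hn
    nlinarith
  have h2' : (n : ℝ) ≤ 2 * ((n / 2 ^ R : ℕ) * (2 : ℝ) ^ R) := by exact_mod_cast h2
  have h1' : ((n / 2 ^ R : ℕ) : ℝ) * (S.card : ℝ) ≤ exU n U := by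
    rw [hc'] at h1; exact_mod_cast h1
  rw [le_div_iff₀ hnpos]
  refine le_trans ?_ h1'
  set d : ℝ := ((n / 2 ^ R : ℕ) : ℝ)
  calc (3 / 16 : ℝ) * (3 / 2) ^ R * n ≤ (3 / 16) * (3 / 2) ^ R * (2 * (d * (2 : ℝ) ^ R)) := by
        gcongr
    _ = d * (((2 : ℝ) ^ R) ^ 2 * (3 / 4) ^ (R + 1) / 2) := by
        have : (3 / 2 : ℝ) ^ R = 2 ^ R * (3 / 4) ^ R := by rw [← mul_pow]; norm_num
        rw [this, pow_succ (3 / 4 : ℝ)]; ring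
    _ ≤ _ := by gcongr
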